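/- Global Hölder estimates uniform in λ: let f ∈ C(Ω̄) and m > 2, fix x* ∈ Ω with d(x*) > δ₀, and for 0 < λ < 1 set v_λ(x) := u_λ(x) − u_λ(x*), where u_λ is the unique continuous viscosity solution of the state-constraint problem −Δu_λ + |Du_λ|^m + λu_λ = f in Ω, −Δu_λ + |Du_λ|^m + λu_λ ≥ f on ∂Ω. Then there exists a constant K₂ > 0, independent of λ, such that |v_λ(x) − v_λ(y)| ≤ K₂ |x−y|^{(m−2)/(m−1)} for all x, y ∈ Ω̄ and all 0 < λ < 1. -/

import Mathlib

open Set Filter Topology Metric MeasureTheory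

noncomputable section

/-- Euclidean space `ℝ^N`. -/
abbrev Euc (N : ℕ) : Type := EuclideanSpace ℝ (Fin N)

/-- The Laplacian of `φ` at `x`, computed as the trace of the second derivative
in the standard orthonormal basis of `ℝ^N`. -/
noncomputable def lapl {N : ℕ} (φ : Euc N → ℝ) (x : Euc N) : ℝ :=
  ∑ i : Fin N,
    iteratedFDeriv ℝ 2 φ x ![EuclideanSpace.single i 1, EuclideanSpace.single i 1]

/-- `Ω` is a domain with `C²` boundary: it is the sublevel set of a `C²`
defining function whose gradient does not vanish on the boundary. -/
def HasC2Boundary {N : ℕ} (Ω : Set (Euc N)) : Prop :=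
  ∃ ρ : Euc N → ℝ, ContDiff ℝ 2 ρ ∧ Ω = {x | ρ x < 0} ∧
    frontier Ω = {x | ρ x = 0} ∧ ∀ x ∈ frontier Ω, gradient ρ x ≠ 0

/-- The stationary operator `−Δφ(x) + |Dφ(x)|^m + λ r − h(x)` evaluated with the
value `r` of the (sub/super)solution at `x`. -/
noncomputable def statOp {N : ℕ} (h : Euc N → ℝ) (lam m : ℝ)
    (φ : Euc N → ℝ) (r : ℝ) (x : Euc N) : ℝ :=
  -lapl φ x + ‖gradient φ x‖ ^ m + lam * r - h x

/-- Viscosity subsolution of the generalized Dirichlet problem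
`S(Ω,h,k,λ)`: `−Δw + |Dw|^m + λ w = h` in `Ω`, `w = k` on `∂Ω`. -/
def IsStatSub {N : ℕ} (Ω : Set (Euc N)) (h k : Euc N → ℝ) (lam m : ℝ)
    (u : Euc N → ℝ) : Prop :=
  UpperSemicontinuousOn u (closure Ω) ∧
  ∀ φ : Euc N → ℝ, ContDiff ℝ 2 φ → ∀ x₀ ∈ closure Ω,
    IsLocalMaxOn (u - φ) (closure Ω) x₀ →
      (x₀ ∈ Ω → statOp h lam m φ (u x₀) x₀ ≤ 0) ∧
      (x₀ ∈ frontier Ω → min (statOp h lam m φ (u x₀) x₀) (u x₀ - k x₀) ≤ 0)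

/-- Viscosity supersolution of the generalized Dirichlet problem `S(Ω,h,k,λ)`. -/
def IsStatSuper {N : ℕ} (Ω : Set (Euc N)) (h k : Euc N → ℝ) (lam m : ℝ)
    (v : Euc N → ℝ) : Prop :=
  LowerSemicontinuousOn v (closure Ω) ∧
  ∀ φ : Euc N → ℝ, ContDiff ℝ 2 φ → ∀ x₀ ∈ closure Ω,
    IsLocalMinOn (v - φ) (closure Ω) x₀ →
      (x₀ ∈ Ω → 0 ≤ statOp h lam m φ (v x₀) x₀) ∧
      (x₀ ∈ frontier Ω → 0 ≤ max (statOp h lam m φ (v x₀) x₀) (v x₀ - k x₀))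

/-- The parabolic operator
`φ_t(x,t) − Δφ(·,t)(x) + |Dφ(·,t)(x)|^m + λ r − f(x)`. -/
noncomputable def parOp {N : ℕ} (f : Euc N → ℝ) (lam m : ℝ)
    (φ : Euc N × ℝ → ℝ) (r : ℝ) (x : Euc N) (t : ℝ) : ℝ :=
  deriv (fun s => φ (x, s)) t - lapl (fun y => φ (y, t)) x
    + ‖gradient (fun y => φ (y, t)) x‖ ^ m + lam * r - f x

/-- Viscosity subsolution of the generalized initial-boundary value problem
`E(Ω,f,g,u₀,λ)` on the time interval `[0,T]`:
`u_t − Δu + |Du|^m + λ u = f` in `Ω × (0,T]`, `u = g` on `∂Ω × (0,T]`,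
`u(·,0) = u₀` on `closure Ω`. -/
def IsParSub {N : ℕ} (Ω : Set (Euc N)) (f g u₀ : Euc N → ℝ) (lam m T : ℝ)
    (u : Euc N → ℝ → ℝ) : Prop :=
  UpperSemicontinuousOn (fun p : Euc N × ℝ => u p.1 p.2) (closure Ω ×ˢ Ico 0 T) ∧
  (∀ x ∈ closure Ω, u x 0 ≤ u₀ x) ∧
  ∀ φ : Euc N × ℝ → ℝ, ContDiff ℝ 2 φ → ∀ x₀ : Euc N, ∀ t₀ : ℝ,
    (x₀, t₀) ∈ closure Ω ×ˢ Ioc 0 T →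
    IsLocalMaxOn (fun p : Euc N × ℝ => u p.1 p.2 - φ p) (closure Ω ×ˢ Ioc 0 T) (x₀, t₀) →
      (x₀ ∈ Ω → parOp f lam m φ (u x₀ t₀) x₀ t₀ ≤ 0) ∧
      (x₀ ∈ frontier Ω →
        min (parOp f lam m φ (u x₀ t₀) x₀ t₀) (u x₀ t₀ - g x₀) ≤ 0)

/-- Viscosity supersolution of `E(Ω,f,g,u₀,λ)` on the time interval `[0,T]`. -/
def IsParSuper {N : ℕ} (Ω : Set (Euc N)) (f g u₀ : Euc N → ℝ) (lam m T : ℝ)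
    (v : Euc N → ℝ → ℝ) : Prop :=
  LowerSemicontinuousOn (fun p : Euc N × ℝ => v p.1 p.2) (closure Ω ×ˢ Icc 0 T) ∧
  (∀ x ∈ closure Ω, u₀ x ≤ v x 0) ∧
  ∀ φ : Euc N × ℝ → ℝ, ContDiff ℝ 2 φ → ∀ x₀ : Euc N, ∀ t₀ : ℝ,
    (x₀, t₀) ∈ closure Ω ×ˢ Ioc 0 T →
    IsLocalMinOn (fun p : Euc N × ℝ => v p.1 p.2 - φ p) (closure Ω ×ˢ Ioc 0 T) (x₀, t₀) →
      (x₀ ∈ Ω → 0 ≤ parOp f lam m φ (v x₀ t₀) x₀ t₀) ∧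
      (x₀ ∈ frontier Ω →
        0 ≤ max (parOp f lam m φ (v x₀ t₀) x₀ t₀) (v x₀ t₀ - g x₀))

/-- A continuous viscosity solution, global in time, of `E(Ω,f,g,u₀,λ)`. -/
def IsGlobalParSol {N : ℕ} (Ω : Set (Euc N)) (f g u₀ : Euc N → ℝ) (lam m : ℝ)
    (u : Euc N → ℝ → ℝ) : Prop :=
  ContinuousOn (fun p : Euc N × ℝ => u p.1 p.2) (closure Ω ×ˢ Ici 0) ∧
  ∀ T > (0 : ℝ), IsParSub Ω f g u₀ lam m T u ∧ IsParSuper Ω f g u₀ lam m T u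

open scoped Classical in
/-- Redefinition of a parabolic subsolution on the lateral boundary by its
`limsup` from inside `Ω × (0,T]`. -/
noncomputable def uscExtPar {N : ℕ} (Ω : Set (Euc N)) (T : ℝ)
    (u : Euc N → ℝ → ℝ) : Euc N → ℝ → ℝ :=
  fun z t => if z ∈ Ω then u z t
    else limsup (fun p : Euc N × ℝ => u p.1 p.2) (𝓝[Ω ×ˢ Ioc 0 T] (z, t))

open scoped Classical in
/-- Redefinition of a stationary subsolution on the boundary by its `limsup`
from inside `Ω`. -/
noncomputable def uscExtStat {N : ℕ} (Ω : Set (Euc N))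
    (u : Euc N → ℝ) : Euc N → ℝ :=
  fun z => if z ∈ Ω then u z else limsup u (𝓝[Ω] z)

/-- Continuous viscosity solution of the state constraint problem
`−Δw + |Dw|^m + λ w = h` in `Ω`, `−Δw + |Dw|^m + λ w ≥ h` on `∂Ω`. -/
def IsSCSolution {N : ℕ} (Ω : Set (Euc N)) (h : Euc N → ℝ) (lam m : ℝ)
    (w : Euc N → ℝ) : Prop :=
  ContinuousOn w (closure Ω) ∧
  (∀ φ : Euc N → ℝ, ContDiff ℝ 2 φ → ∀ x₀ ∈ Ω, IsLocalMaxOn (w - φ) Ω x₀ →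
      statOp h lam m φ (w x₀) x₀ ≤ 0) ∧
  (∀ φ : Euc N → ℝ, ContDiff ℝ 2 φ → ∀ x₀ ∈ closure Ω,
      IsLocalMinOn (w - φ) (closure Ω) x₀ → 0 ≤ statOp h lam m φ (w x₀) x₀)

/-- Continuous viscosity subsolution of `−Δu + |Du|^m ≤ h` in `Ω`
(no boundary condition). -/
def IsIntSub {N : ℕ} (Ω : Set (Euc N)) (h : Euc N → ℝ) (m : ℝ)
    (u : Euc N → ℝ) : Prop :=
  ∀ φ : Euc N → ℝ, ContDiff ℝ 2 φ → ∀ x₀ ∈ Ω, IsLocalMaxOn (u - φ) Ω x₀ →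
    statOp h 0 m φ (u x₀) x₀ ≤ 0

/-- Hölder continuity with exponent `α` on a set. -/
def HolderOnCl {N : ℕ} (α : ℝ) (s : Set (Euc N)) (w : Euc N → ℝ) : Prop :=
  ∃ C > (0 : ℝ), ∀ x ∈ s, ∀ y ∈ s, |w x - w y| ≤ C * ‖x - y‖ ^ α

/-- Local Lipschitz continuity inside `Ω`. -/
def LocLipIn {N : ℕ} (Ω : Set (Euc N)) (w : Euc N → ℝ) : Prop :=
  ∀ x ∈ Ω, ∃ ε > (0 : ℝ), ∃ K : ℝ, 0 ≤ K ∧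
    ∀ y ∈ ball x ε ∩ Ω, ∀ z ∈ ball x ε ∩ Ω, |w y - w z| ≤ K * ‖y - z‖

/-- A piecewise `C¹` path parametrized on `[0,1]`. -/
def IsPWC1Path {N : ℕ} (γ : ℝ → Euc N) : Prop :=
  ContinuousOn γ (Icc 0 1) ∧
  ∃ n : ℕ, ∃ τ : Fin (n + 1) → ℝ, StrictMono τ ∧ τ 0 = 0 ∧ τ (Fin.last n) = 1 ∧
    ∀ i : Fin n, ContDiffOn ℝ 1 γ (Icc (τ i.castSucc) (τ i.succ))

/-- The length of a path on `[0,1]`. -/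
noncomputable def pathLen {N : ℕ} (γ : ℝ → Euc N) : ℝ :=
  ∫ t in (0 : ℝ)..1, ‖derivWithin γ (Icc (0 : ℝ) 1) t‖

/-- The geodesic-type distance inside `closure S` via piecewise `C¹` paths. -/
noncomputable def dTilde {N : ℕ} (S : Set (Euc N)) (x y : Euc N) : ℝ :=
  sInf {L : ℝ | ∃ γ : ℝ → Euc N, IsPWC1Path γ ∧ γ 0 = x ∧ γ 1 = y ∧
    MapsTo γ (Icc 0 1) (closure S) ∧ L = pathLen γ}

/-- The inner parallel set `Ω_δ = {x ∈ Ω : dist(x,∂Ω) > δ}`. -/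
def innerSet {N : ℕ} (Ω : Set (Euc N)) (δ : ℝ) : Set (Euc N) :=
  {x ∈ Ω | δ < infDist x (frontier Ω)}

end

/-- Scalar inequality behind the blow-up barrier. -/
lemma hld_scalar (m : ℝ) (hm : 2 < m) (N : ℕ) (C : ℝ) (hC : 0 ≤ C) (a : ℝ)
    (ha : a = (m - 2) / (m - 1) / 2) :
    ∃ A > (0 : ℝ), ∀ t : ℝ, 0 < t → t < 1 →
      4 * (A * (a * (a - 1) * t ^ (a - 2) + 2 * ((1 - t)⁻¹) ^ 3)) * t
        + 2 * N * (A * (a * t ^ (a - 1) + ((1 - t)⁻¹) ^ 2)) + C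
      < (2 * (A * (a * t ^ (a - 1) + ((1 - t)⁻¹) ^ 2)) * √t) ^ m := by
  have hm1 : 0 < m - 1 := by linarith
  have ha0 : 0 < a := by rw [ha]; have : 0 < m - 2 := by linarith
                         positivity
  have ha1 : a < 1 := by
    rw [ha, div_div, div_lt_one (by positivity)]; linarith
  have hexp : (a - 1 / 2) * m = a - 1 := by
    rw [ha]; field_simp; ring
  set I : ℝ := (a ^ m)⁻¹ with hI
  have ham : 0 < a ^ m := Real.rpow_pos_of_pos ha0 m
  have hI0 : 0 < I := inv_pos.mpr ham
  set M : ℝ := 8 * I + 2 ^ m with hM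
  have h2m : (0 : ℝ) < 2 ^ m := Real.rpow_pos_of_pos (by norm_num) m
  have hM0 : 0 < M := by positivity
  set C1 : ℝ := 8 * M + 2 * N * (a * I + M) with hC1
  have hC10 : 0 ≤ C1 := by positivity
  set C2 : ℝ := C * I with hC2
  have hC20 : 0 ≤ C2 := by positivity
  set A : ℝ := C1 + C2 + 1 with hA
  have hA1 : 1 ≤ A := by linarith
  refine ⟨A, by linarith, fun t ht0 ht1 => ?_⟩
  have hs : 0 < 1 - t := by linarith
  set v : ℝ := (1 - t)⁻¹ with hv
  have hv1 : 1 ≤ v := (one_le_inv₀ hs).mpr (by linarith)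
  have hta : 0 < t ^ (a - 1) := Real.rpow_pos_of_pos ht0 _
  have hst : 0 < √t := Real.sqrt_pos.mpr ht0
  set Q : ℝ := (a * t ^ (a - 1) + v ^ 2) * √t with hQ
  have hQ0 : 0 < Q := by positivity
  have hQm0 : 0 < Q ^ m := Real.rpow_pos_of_pos hQ0 m
  have h1 : t ^ (a - 1) ≤ I * Q ^ m := by
    have : a * t ^ (a - 1 / 2) ≤ Q := by
      have e : t ^ (a - 1 / 2) = t ^ (a - 1) * √t := by
        rw [Real.sqrt_eq_rpow, ← Real.rpow_add ht0]; congr 1; ring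
      rw [hQ, e]
      have : 0 ≤ v ^ 2 * √t := by positivity
      nlinarith
    have h := Real.rpow_le_rpow (by positivity) this (by linarith : (0:ℝ) ≤ m)
    rw [Real.mul_rpow ha0.le (by positivity), ← Real.rpow_mul ht0.le, hexp] at h
    rw [hI, inv_mul_eq_div, le_div_iff₀ ham]; linarith
  have h2 : 1 ≤ t ^ (a - 1) :=
    Real.one_le_rpow_of_pos_of_le_one_of_nonpos ht0 ht1.le (by linarith)
  have h3 : v ^ 3 ≤ M * Q ^ m := by
    rcases le_total t (1 / 2) with h | h
    · have : v ≤ 2 := by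
        rw [hv, inv_le_comm₀ hs (by norm_num)]; linarith
      have : v ^ 3 ≤ 2 ^ 3 := by gcongr
      have : 0 ≤ 2 ^ m * Q ^ m := by positivity
      have : M * Q ^ m = 8 * (I * Q ^ m) + 2 ^ m * Q ^ m := by rw [hM]; ring
      linarith
    · have hsq : 1 / 2 ≤ √t := by
        apply Real.le_sqrt_of_sq_le; linarith
      have hv2 : v ^ 2 ≤ 2 * Q := by
        rw [hQ]
        have : 0 ≤ a * t ^ (a - 1) * √t := by positivity
        nlinarith [sq_nonneg v]
      have h := Real.rpow_le_rpow (by positivity) hv2 (by linarith : (0:ℝ) ≤ m)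
      rw [Real.mul_rpow (by norm_num) hQ0.le] at h
      have h4 : v ^ 3 ≤ (v ^ 2) ^ m := by
        calc v ^ 3 ≤ (v ^ 2) ^ 2 := by
              rw [← pow_mul]; exact pow_le_pow_right₀ hv1 (by norm_num)
          _ = (v ^ 2) ^ (2 : ℝ) := by norm_cast
          _ ≤ _ := Real.rpow_le_rpow_of_exponent_le (one_le_pow₀ hv1) hm.le
      have : 0 ≤ 8 * I * Q ^ m := by positivity
      have : M * Q ^ m = 8 * I * Q ^ m + 2 ^ m * Q ^ m := by rw [hM]; ring
      linarith
  have h3' : v ^ 2 ≤ M * Q ^ m := (pow_le_pow_right₀ hv1 (by norm_num)).trans h3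
  have hR : (2 * (A * (a * t ^ (a - 1) + v ^ 2)) * √t) ^ m = (2 * A) ^ m * Q ^ m := by
    rw [← Real.mul_rpow (by positivity) hQ0.le]; congr 1; rw [hQ]; ring
  rw [hR]
  have hbig : C1 * A + C2 < (2 * A) ^ m := by
    have : A ^ 2 ≤ (2 * A) ^ m := by
      calc A ^ 2 ≤ (2 * A) ^ 2 := by gcongr; linarith
        _ = (2 * A) ^ (2 : ℝ) := by norm_cast
        _ ≤ _ := Real.rpow_le_rpow_of_exponent_le (by linarith) hm.le
    nlinarith
  have hneg : a * (a - 1) * t ^ (a - 2) ≤ 0 := by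
    have : 0 < t ^ (a - 2) := Real.rpow_pos_of_pos ht0 _
    have : 0 ≤ a * (1 - a) * t ^ (a - 2) := by
      have : 0 ≤ 1 - a := by linarith
      positivity
    linarith
  have e1 : 4 * (A * (a * (a - 1) * t ^ (a - 2) + 2 * v ^ 3)) * t ≤ 8 * A * (M * Q ^ m) := by
    calc _ ≤ 4 * (A * (0 + 2 * v ^ 3)) * t := by gcongr
      _ = 8 * A * v ^ 3 * t := by ring
      _ ≤ 8 * A * v ^ 3 * 1 := by gcongr
      _ ≤ _ := by rw [mul_one]; gcongr
  have e2 : 2 * N * (A * (a * t ^ (a - 1) + v ^ 2))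
      ≤ 2 * N * (A * (a * (I * Q ^ m) + M * Q ^ m)) := by gcongr
  have e3 : C ≤ C * (I * Q ^ m) := le_mul_of_one_le_right hC (h2.trans h1)
  calc _ ≤ 8 * A * (M * Q ^ m) + 2 * N * (A * (a * (I * Q ^ m) + M * Q ^ m))
          + C * (I * Q ^ m) := by gcongr
    _ = (C1 * A + C2) * Q ^ m := by rw [hC1, hC2]; ring
    _ < _ := by gcongr

/-- Gradient and Laplacian of a radial function. -/
lemma hld_radial {N : ℕ} (x₀ p : Euc N) (H H1 : ℝ → ℝ) (h2 : ℝ)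
    (hH : ∀ᶠ s in 𝓝 (‖p - x₀‖ ^ 2), HasDerivAt H (H1 s) s)
    (hH1 : HasDerivAt H1 h2 (‖p - x₀‖ ^ 2)) :
    ‖gradient (fun y => H (‖y - x₀‖ ^ 2)) p‖ = 2 * |H1 (‖p - x₀‖ ^ 2)| * ‖p - x₀‖ ∧
    lapl (fun y => H (‖y - x₀‖ ^ 2)) p
      = 4 * h2 * ‖p - x₀‖ ^ 2 + 2 * N * H1 (‖p - x₀‖ ^ 2) := by
  have hn : ∀ y : Euc N, HasFDerivAt (fun y => ‖y - x₀‖ ^ 2)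
      (2 • (innerSL ℝ (y - x₀))) y := fun y => by
    have := (hasFDerivAt_id y).sub_const x₀ |>.norm_sq
    simpa using this
  have hc : Tendsto (fun y : Euc N => ‖y - x₀‖ ^ 2) (𝓝 p) (𝓝 (‖p - x₀‖ ^ 2)) := by
    have : Continuous (fun y : Euc N => ‖y - x₀‖ ^ 2) := by fun_prop
    exact this.tendsto p
  have hD : ∀ y, HasDerivAt H (H1 (‖y - x₀‖ ^ 2)) (‖y - x₀‖ ^ 2) →
      HasFDerivAt (fun y => H (‖y - x₀‖ ^ 2))
        (H1 (‖y - x₀‖ ^ 2) • (2 • (innerSL ℝ (y - x₀)))) y := fun y h =>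
    h.comp_hasFDerivAt y (hn y)
  have hev : fderiv ℝ (fun y => H (‖y - x₀‖ ^ 2)) =ᶠ[𝓝 p]
      fun y => H1 (‖y - x₀‖ ^ 2) • (2 • (innerSL ℝ (y - x₀))) :=
    (hc.eventually hH).mono fun y hy => (hD y hy).fderiv
  constructor
  · rw [gradient, LinearIsometryEquiv.norm_map, hev.self_of_nhds, norm_smul, ← Nat.cast_smul_eq_nsmul ℝ, norm_smul,
      innerSL_apply_norm]
    simp; ring
  · have hL : HasFDerivAt (fun y : Euc N => (2 • (innerSL ℝ (y - x₀)) : Euc N →L[ℝ] ℝ))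
        (2 • (innerSL ℝ : Euc N →L[ℝ] Euc N →L[ℝ] ℝ)) p := by
      have := ((innerSL ℝ : Euc N →L[ℝ] Euc N →L[ℝ] ℝ).hasFDerivAt (x := p - x₀)).comp p
        ((hasFDerivAt_id p).sub_const x₀)
      exact this.const_smul 2
    have hF := (hH1.comp_hasFDerivAt p (hn p)).smul hL
    have hF' := hF.congr_of_eventuallyEq hev
    unfold lapl
    simp only [iteratedFDeriv_two_apply, hF'.fderiv]
    have hself : ∀ i : Fin N, ((innerSL ℝ) (EuclideanSpace.single i (1 : ℝ)))
        (EuclideanSpace.single i (1 : ℝ)) = 1 := fun i => by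
      rw [innerSL_apply_apply, real_inner_self_eq_norm_sq]; simp
    have hnorm : ‖p - x₀‖ ^ 2 = ∑ i, (p i - x₀ i) ^ 2 := by
      rw [EuclideanSpace.norm_sq_eq]; simp
    have hsum : ∑ x, h2 * (2 * (p x - x₀ x)) * (2 * (p x - x₀ x))
        = 4 * h2 * ‖p - x₀‖ ^ 2 := by
      rw [hnorm, Finset.mul_sum]
      exact Finset.sum_congr rfl fun i _ => by ring
    simp [Finset.sum_add_distrib, EuclideanSpace.inner_single_right, hself]
    rw [hsum]; ring

/-- A locally `C²` function agrees near a point with a globally `C²` one. -/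
lemma hld_extend {N : ℕ} (φ : Euc N → ℝ) (p : Euc N) (hφ : ContDiffAt ℝ 2 φ p) :
    ∃ ψ : Euc N → ℝ, ContDiff ℝ 2 ψ ∧ ψ =ᶠ[𝓝 p] φ := by
  obtain ⟨ε, hε, hb⟩ := Metric.eventually_nhds_iff.mp (hφ.eventually (by simp))
  let b : ContDiffBump p := ⟨ε / 4, ε / 2, by linarith, by linarith⟩
  refine ⟨fun y => b y * φ y, ?_, ?_⟩
  · rw [contDiff_iff_contDiffAt]
    intro y
    by_cases hy : dist y p < ε
    · exact (b.contDiff.contDiffAt).mul (hb hy)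
    · have : y ∉ tsupport b := by
        rw [b.tsupport_eq]
        simp only [Metric.mem_closedBall, not_le]
        show ε / 2 < _
        linarith
      have h0 := notMem_tsupport_iff_eventuallyEq.mp this
      refine (contDiffAt_const (c := (0 : ℝ))).congr_of_eventuallyEq ?_
      filter_upwards [h0] with z hz
      simp [hz]
  · filter_upwards [b.eventuallyEq_one] with z hz
    simp [hz]

/-- Subsolution property with locally `C²` test functions. -/
lemma hld_sub_local {N : ℕ} {Ω : Set (Euc N)} {f : Euc N → ℝ} {lam m : ℝ} {u : Euc N → ℝ}
    (hu : IsSCSolution Ω f lam m u) (φ : Euc N → ℝ) (p : Euc N) (hp : p ∈ Ω)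
    (hφ : ContDiffAt ℝ 2 φ p) (hmax : IsLocalMax (u - φ) p) :
    statOp f lam m φ (u p) p ≤ 0 := by
  obtain ⟨ψ, hψ, he⟩ := hld_extend φ p hφ
  have hmax' : IsLocalMax (u - ψ) p := by
    filter_upwards [hmax, he] with y hy hey
    simp only [Pi.sub_apply] at hy ⊢
    rw [hey, he.self_of_nhds]; exact hy
  have h := hu.2.1 ψ hψ p hp (hmax'.filter_mono nhdsWithin_le_nhds)
  have e1 : gradient ψ p = gradient φ p := by
    unfold gradient; rw [he.fderiv_eq]
  have e2 : lapl ψ p = lapl φ p := by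
    unfold lapl; rw [(he.iteratedFDeriv ℝ 2).self_of_nhds]
  unfold statOp at h ⊢
  rwa [e1, e2] at h

/-- Lower bound `λ u ≥ -F`. -/
lemma hld_lower {N : ℕ} {Ω : Set (Euc N)} {f : Euc N → ℝ} {lam m : ℝ} {u : Euc N → ℝ}
    (hc : IsCompact (closure Ω)) (hm : 2 < m) (hl : 0 < lam)
    (hu : IsSCSolution Ω f lam m u) (F : ℝ) (hF : ∀ x ∈ closure Ω, |f x| ≤ F) :
    ∀ x ∈ closure Ω, f x - lam * u x ≤ 2 * F := by
  intro x hx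
  obtain ⟨z, hz, hmin⟩ := hc.exists_isMinOn ⟨x, hx⟩ hu.1
  have h := hu.2.2 (fun _ => 0) contDiff_const z hz (by
    have : u - (fun _ => (0 : ℝ)) = u := by ext; simp
    rw [this]; exact hmin.localize)
  have e1 : gradient (fun _ : Euc N => (0 : ℝ)) z = 0 := by simp [gradient]
  have e2 : lapl (fun _ : Euc N => (0 : ℝ)) z = 0 := by
    unfold lapl
    apply Finset.sum_eq_zero; intro i _
    simp
  unfold statOp at h
  rw [e1, e2, norm_zero, Real.zero_rpow (by linarith)] at h
  have h1 : u z ≤ u x := hmin hx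
  have h2 := abs_le.mp (hF z hz)
  have h3 := abs_le.mp (hF x hx)
  nlinarith [mul_le_mul_of_nonneg_left h1 hl.le]

set_option maxHeartbeats 1000000 in
/-- One-sided interior Hölder estimate, uniform in `λ` and in the radius. -/
lemma hld_interior {N : ℕ} {Ω : Set (Euc N)} {f : Euc N → ℝ} {m : ℝ}
    (hc : IsCompact (closure Ω)) (hm : 2 < m) (hf : ContinuousOn f (closure Ω)) :
    ∃ A > (0 : ℝ), ∀ lam : ℝ, 0 < lam → ∀ u : Euc N → ℝ, IsSCSolution Ω f lam m u →
      ∀ x₀ : Euc N, ∀ r : ℝ, 0 < r → r ≤ 1 → closedBall x₀ r ⊆ Ω → ∀ y : Euc N,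
        ‖y - x₀‖ ≤ r / 2 → u y - u x₀ ≤ A * ‖y - x₀‖ ^ ((m - 2) / (m - 1)) := by
  obtain ⟨F, hF⟩ : ∃ F : ℝ, ∀ x ∈ closure Ω, |f x| ≤ F := by
    obtain ⟨F, hF⟩ := hc.exists_bound_of_continuousOn hf
    exact ⟨F, fun x hx => by simpa using hF x hx⟩
  set α : ℝ := (m - 2) / (m - 1) with hα
  obtain ⟨A, hA, hkey⟩ := hld_scalar m hm N (2 * |F|) (by positivity) (α / 2) rfl
  have hm1 : 0 < m - 1 := by linarith
  have hα0 : 0 < α := div_pos (by linarith) hm1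
  have hα1 : α < 1 := by rw [hα, div_lt_one hm1]; linarith
  have hexp : (α - 1) * m = α - 2 := by rw [hα]; field_simp; ring
  set a := α / 2 with ha
  refine ⟨3 * A, by positivity, fun lam hl u hu x₀ r hr hr1 hball y hy => ?_⟩
  have hlow := hld_lower hc hm hl hu F hF
  set k : ℝ := r ^ α with hk
  have hk0 : 0 < k := Real.rpow_pos_of_pos hr _
  have hr2 : 0 < r ^ 2 := by positivity
  set H : ℝ → ℝ := fun s => k * (A * ((s / r ^ 2) ^ a + (1 - s / r ^ 2)⁻¹ - 1)) with hH
  set H1 : ℝ → ℝ := fun s => k / r ^ 2 *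
    (A * (a * (s / r ^ 2) ^ (a - 1) + ((1 - s / r ^ 2)⁻¹) ^ 2)) with hH1
  set φ : Euc N → ℝ := fun y => H (‖y - x₀‖ ^ 2) with hφ
  have hφ0 : φ x₀ = 0 := by
    simp [hφ, hH, Real.zero_rpow (by positivity : a ≠ 0)]
  -- the barrier estimate
  have hmain : ∀ y : Euc N, ‖y - x₀‖ < r → u y - u x₀ ≤ φ y := by
    intro y hy
    by_contra hcon
    push Not at hcon
    have hcl : closedBall x₀ r ⊆ closure Ω := hball.trans subset_closure
    obtain ⟨M, hM⟩ : ∃ M : ℝ, ∀ z ∈ closedBall x₀ r, u z ≤ M := by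
      obtain ⟨M, hM⟩ := (isCompact_closedBall x₀ r).exists_bound_of_continuousOn
        (hu.1.mono hcl)
      exact ⟨M, fun z hz => (le_abs_self _).trans (hM z hz)⟩
    set L : ℝ := (M - u x₀) / (k * A) with hL
    set t1 : ℝ := max (‖y - x₀‖ ^ 2 / r ^ 2) (1 - (|L| + 2)⁻¹) with ht1
    have hL2 : 0 < |L| + 2 := by positivity
    have ht1lt : t1 < 1 := by
      apply max_lt
      · rw [div_lt_one hr2]; gcongr
      · have := inv_pos.mpr hL2; linarith
    set S : Set (Euc N) := {z | ‖z - x₀‖ ^ 2 / r ^ 2 ≤ t1} with hS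
    have hcont : Continuous (fun z : Euc N => ‖z - x₀‖ ^ 2 / r ^ 2) := by fun_prop
    have hSball : S ⊆ closedBall x₀ r := by
      intro z hz
      have h1 : ‖z - x₀‖ ^ 2 / r ^ 2 ≤ 1 := le_trans hz ht1lt.le
      rw [div_le_one hr2] at h1
      rw [mem_closedBall, dist_eq_norm]
      exact le_of_sq_le_sq h1 hr.le
    have hScomp : IsCompact S :=
      (isCompact_closedBall x₀ r).of_isClosed_subset (isClosed_le hcont continuous_const) hSball
    have hyS : y ∈ S := by
      show ‖y - x₀‖ ^ 2 / r ^ 2 ≤ t1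
      exact le_max_left _ _
    have hφcont : ContinuousOn φ S := by
      have h1 : ContinuousOn (fun z : Euc N => (1 - ‖z - x₀‖ ^ 2 / r ^ 2)⁻¹) S := by
        refine ContinuousOn.inv₀ (continuous_const.sub hcont).continuousOn ?_
        intro z hz
        have : ‖z - x₀‖ ^ 2 / r ^ 2 < 1 := lt_of_le_of_lt hz ht1lt
        linarith
      have h2 : ContinuousOn (fun z : Euc N => (‖z - x₀‖ ^ 2 / r ^ 2) ^ a) S :=
        hcont.continuousOn.rpow_const fun _ _ => Or.inr (by positivity)
      exact continuousOn_const.mul (continuousOn_const.mul ((h2.add h1).sub continuousOn_const))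
    obtain ⟨p, hpS, hpmax⟩ := hScomp.exists_isMaxOn ⟨y, hyS⟩
      ((hu.1.mono (hSball.trans hcl)).sub hφcont)
    have hpy : u y - φ y ≤ u p - φ p := hpmax hyS
    have hpx : p ≠ x₀ := by
      rintro rfl
      rw [hφ0] at hpy; linarith
    have hpt : ‖p - x₀‖ ^ 2 / r ^ 2 < t1 := by
      refine lt_of_le_of_ne hpS fun heq => ?_
      have h1 : |L| + 2 ≤ (1 - t1)⁻¹ := by
        rw [le_inv_comm₀ hL2 (by linarith)]
        have := le_max_right (‖y - x₀‖ ^ 2 / r ^ 2) (1 - (|L| + 2)⁻¹)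
        linarith
      have h2 : φ p ≥ k * (A * (L + 1)) := by
        simp only [hφ, hH]
        rw [heq]
        have ht10 : 0 ≤ t1 := le_trans (by positivity) (le_max_left _ _)
        have : 0 ≤ t1 ^ a := Real.rpow_nonneg ht10 _
        have : L ≤ |L| := le_abs_self L
        have : L + 1 ≤ t1 ^ a + (1 - t1)⁻¹ - 1 := by linarith
        gcongr
      have h3 : k * (A * L) = M - u x₀ := by rw [hL]; field_simp
      have h4 := hM p (hSball hpS)
      have : 0 < k * A := by positivity
      nlinarith
    have hpmaxloc : IsLocalMax (u - φ) p := by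
      refine hpmax.isLocalMax ?_
      filter_upwards [(isOpen_lt hcont continuous_const).mem_nhds hpt] with z hz
      exact le_of_lt hz
    have hnp : 0 < ‖p - x₀‖ := norm_pos_iff.mpr (sub_ne_zero.mpr hpx)
    set t : ℝ := ‖p - x₀‖ ^ 2 / r ^ 2 with ht
    have ht0 : 0 < t := by positivity
    have htlt : t < 1 := hpt.trans ht1lt
    have hφC : ContDiffAt ℝ 2 φ p := by
      have hq : ContDiffAt ℝ 2 (fun z : Euc N => ‖z - x₀‖ ^ 2 / r ^ 2) p := by
        have : ContDiffAt ℝ 2 (fun z : Euc N => ‖z - x₀‖ ^ 2) p :=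
          ((contDiff_id.sub contDiff_const).norm_sq ℝ).contDiffAt
        exact this.div_const _
      have h1 := (contDiffAt_const (c := (1 : ℝ))).sub hq |>.inv (by linarith)
      have h2 := hq.rpow_const_of_ne (p := a) (ne_of_gt ht0)
      exact contDiffAt_const.mul (contDiffAt_const.mul ((h2.add h1).sub contDiffAt_const))
    have hvis := hld_sub_local hu φ p (hball (hSball hpS)) hφC hpmaxloc
    have hdiv : ∀ s : ℝ, HasDerivAt (fun s : ℝ => s / r ^ 2) (1 / r ^ 2) s := fun s =>
      (hasDerivAt_id s).div_const _
    have hinv : ∀ s : ℝ, s / r ^ 2 < 1 → HasDerivAt (fun s : ℝ => (1 - s / r ^ 2)⁻¹)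
        (1 / r ^ 2 * ((1 - s / r ^ 2)⁻¹) ^ 2) s := fun s hs => by
      have h := ((hdiv s).const_sub 1).fun_inv (by linarith)
      refine h.congr_deriv ?_
      have : (1 - s / r ^ 2) ≠ 0 := by linarith
      field_simp
    have hpow : ∀ b : ℝ, ∀ s : ℝ, 0 < s / r ^ 2 → HasDerivAt (fun s : ℝ => (s / r ^ 2) ^ b)
        (1 / r ^ 2 * b * (s / r ^ 2) ^ (b - 1)) s := fun b s hs =>
      (hdiv s).rpow_const (Or.inl hs.ne')
    obtain ⟨hgrad, hlap⟩ := hld_radial x₀ p H H1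
      (k / r ^ 2 / r ^ 2 * (A * (a * (a - 1) * t ^ (a - 2) + 2 * ((1 - t)⁻¹) ^ 3)))
      (by
        have hsc : Continuous (fun s : ℝ => s / r ^ 2) := by fun_prop
        filter_upwards [(isOpen_lt hsc continuous_const).mem_nhds htlt,
          (isOpen_lt continuous_const hsc).mem_nhds ht0] with s hs1 hs0
        have h := ((((hpow a s hs0).add (hinv s hs1)).sub_const 1).const_mul A).const_mul k
        refine h.congr_deriv ?_
        simp only [hH1]; ring)
      (by
        have h := ((((hpow (a - 1) _ ht0).const_mul a).add ((hinv _ htlt).pow 2)).const_mul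
          A).const_mul (k / r ^ 2)
        refine h.congr_deriv ?_
        rw [← ht, show a - 1 - 1 = a - 2 by ring]
        generalize (1 - t)⁻¹ = w
        push_cast
        ring)
    have hkey' := hkey t ht0 htlt
    set G1 : ℝ := A * (a * t ^ (a - 1) + ((1 - t)⁻¹) ^ 2) with hG1
    set G2 : ℝ := A * (a * (a - 1) * t ^ (a - 2) + 2 * ((1 - t)⁻¹) ^ 3) with hG2
    have hH1p : H1 (‖p - x₀‖ ^ 2) = k / r ^ 2 * G1 := rfl
    have hG10 : 0 < G1 := by
      have : 0 < t ^ (a - 1) := Real.rpow_pos_of_pos ht0 _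
      positivity
    have hsqrt : ‖p - x₀‖ = r * √t := by
      rw [ht, Real.sqrt_div (by positivity), Real.sqrt_sq hnp.le, Real.sqrt_sq hr.le]
      field_simp
    have hkr2 : k / r ^ 2 = r ^ (α - 2) := by
      rw [hk, Real.rpow_sub hr]; norm_cast
    have hkr1 : k / r = r ^ (α - 1) := by
      rw [hk, Real.rpow_sub hr, Real.rpow_one]
    have hgradm : ‖gradient φ p‖ ^ m = k / r ^ 2 * (2 * G1 * √t) ^ m := by
      have e : ‖gradient φ p‖ = k / r * (2 * G1 * √t) := by
        rw [hgrad, hH1p, abs_of_pos (by positivity), hsqrt]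
        field_simp
      rw [e, Real.mul_rpow (by positivity) (by positivity), hkr1, ← Real.rpow_mul hr.le, hexp,
        hkr2]
    have hlap' : lapl φ p = k / r ^ 2 * (4 * G2 * t + 2 * N * G1) := by
      rw [hlap, hH1p, ht]; field_simp
    have hbig : 1 ≤ k / r ^ 2 := by
      rw [hkr2]
      exact Real.one_le_rpow_of_pos_of_le_one_of_nonpos hr hr1 (by linarith)
    have hfin := hlow p (hcl (hSball hpS))
    unfold statOp at hvis
    rw [hgradm, hlap'] at hvis
    have hFF := le_abs_self F
    have : 2 * |F| ≤ k / r ^ 2 * (2 * |F|) := le_mul_of_one_le_left (by positivity) hbig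
    have : k / r ^ 2 * (4 * G2 * t + 2 * N * G1 + 2 * |F|) < k / r ^ 2 * (2 * G1 * √t) ^ m := by
      gcongr
    rw [mul_add (k / r ^ 2)] at this
    linarith
  refine (hmain y (by linarith)).trans ?_
  have hny := norm_nonneg (y - x₀)
  set t : ℝ := ‖y - x₀‖ ^ 2 / r ^ 2 with ht
  have ht0 : 0 ≤ t := by positivity
  have ht4 : t ≤ 1 / 4 := by
    rw [ht, div_le_iff₀ hr2]; nlinarith
  have hkt : k * t ^ a = ‖y - x₀‖ ^ α := by
    have e : ((2 : ℕ) : ℝ) * a = α := by rw [ha]; push_cast; ring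
    rw [ht, ← div_pow, ← Real.rpow_natCast, ← Real.rpow_mul (by positivity), e, hk,
      ← Real.mul_rpow hr.le (by positivity)]
    congr 1; field_simp
  have hta : t ≤ t ^ a := by
    rcases ht0.eq_or_lt with h | h
    · rw [← h, Real.zero_rpow (by positivity)]
    · exact Real.self_le_rpow_of_le_one ht0 (by linarith) (by linarith)
  have hi : (1 - t)⁻¹ - 1 ≤ 2 * t := by
    have : (1 - t)⁻¹ ≤ 1 + 2 * t := by
      rw [inv_le_iff_one_le_mul₀ (by linarith)]; nlinarith
    linarith
  calc φ y = k * (A * (t ^ a + (1 - t)⁻¹ - 1)) := rfl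
    _ ≤ k * (A * (3 * t ^ a)) := by gcongr; linarith
    _ = 3 * A * (k * t ^ a) := by ring
    _ = _ := by rw [hkt]

/-- Uniform interior cone condition near each point of the closure. -/
lemma hld_cone {N : ℕ} {Ω : Set (Euc N)} (hΩo : IsOpen Ω) (hΩ2 : HasC2Boundary Ω)
    (z : Euc N) (hz : z ∈ closure Ω) :
    ∃ e : Euc N, ∃ c > (0 : ℝ), c ≤ 1 ∧ ‖e‖ ≤ 1 ∧ ∃ r > (0 : ℝ), r ≤ 1 ∧
      ∀ x ∈ closure Ω, ‖x - z‖ < r → ∀ t : ℝ, 0 < t → t ≤ r →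
        closedBall (x + t • e) (c * t) ⊆ Ω := by
  by_cases hzΩ : z ∈ Ω
  · obtain ⟨ε, hε, hb⟩ := Metric.isOpen_iff.mp hΩo z hzΩ
    refine ⟨0, 1, one_pos, le_rfl, by simp, min (ε / 2) 1, by positivity, min_le_right _ _, ?_⟩
    intro x _ hxz t ht htr w hw
    apply hb
    have h1 : dist w x ≤ t := by simpa using hw
    have h2 : dist x z < ε / 2 := by
      rw [dist_eq_norm]; exact hxz.trans_le (min_le_left _ _)
    have h3 : t ≤ ε / 2 := htr.trans (min_le_left _ _)
    rw [mem_ball]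
    linarith [dist_triangle w x z]
  · obtain ⟨ρ, hρ, hΩeq, hfr, hgrad⟩ := hΩ2
    have hzf : z ∈ frontier Ω := by
      rw [frontier, hΩo.interior_eq]; exact ⟨hz, hzΩ⟩
    set g := gradient ρ z with hg
    have hg0 : 0 < ‖g‖ := norm_pos_iff.mpr (hgrad z hzf)
    have hstrict : HasStrictFDerivAt ρ (fderiv ℝ ρ z) z :=
      hρ.contDiffAt.hasStrictFDerivAt (by norm_num)
    have hlin : ∀ v : Euc N, fderiv ℝ ρ z v = inner ℝ g v := fun v => by
      rw [hg, gradient, InnerProductSpace.toDual_symm_apply]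
    have hcl : ∀ x ∈ closure Ω, ρ x ≤ 0 := fun x hx => by
      have : closure Ω ⊆ {x | ρ x ≤ 0} := by
        apply closure_minimal
        · rw [hΩeq]; intro y hy; exact le_of_lt (show ρ y < 0 from hy)
        · exact isClosed_le hρ.continuous continuous_const
      exact this hx
    have hlo := hstrict.isLittleO.def (c := ‖g‖ / 4) (by positivity)
    rw [nhds_prod_eq] at hlo
    obtain ⟨ε, hε, hb⟩ := Metric.eventually_nhds_iff.mp (by rwa [← nhds_prod_eq] at hlo)
    refine ⟨-(‖g‖⁻¹ • g), 1 / 4, by norm_num, by norm_num, ?_, min (ε / 4) 1, by positivity,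
      min_le_right _ _, ?_⟩
    · rw [norm_neg, norm_smul, norm_inv, norm_norm, inv_mul_cancel₀ hg0.ne']
    intro x hx hxz t ht htr w hw
    have hxz' : ‖x - z‖ < ε / 4 := hxz.trans_le (min_le_left _ _)
    have ht' : t ≤ ε / 4 := htr.trans (min_le_left _ _)
    set e : Euc N := -(‖g‖⁻¹ • g) with he
    have hen : ‖e‖ = 1 := by
      rw [he, norm_neg, norm_smul, norm_inv, norm_norm, inv_mul_cancel₀ hg0.ne']
    set q : Euc N := w - (x + t • e) with hq
    have hqn : ‖q‖ ≤ 1 / 4 * t := by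
      rw [mem_closedBall, dist_eq_norm] at hw; exact hw
    have hwx : w - x = t • e + q := by rw [hq]; abel
    have hwxn : ‖w - x‖ ≤ 5 / 4 * t := by
      rw [hwx]
      refine (norm_add_le _ _).trans ?_
      rw [norm_smul, hen, Real.norm_of_nonneg ht.le]; linarith
    have hd : dist (w, x) (z, z) < ε := by
      rw [Prod.dist_eq]
      apply max_lt
      · rw [dist_eq_norm]
        have : w - z = (w - x) + (x - z) := by abel
        rw [show (w, x).1 - (z, z).1 = w - z from rfl, this]
        linarith [norm_add_le (w - x) (x - z)]
      · rw [dist_eq_norm]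
        show ‖x - z‖ < ε
        linarith
    have h := hb hd
    simp only [hlin] at h
    have h1 : inner ℝ g (w - x) ≤ -(3 / 4) * ‖g‖ * t := by
      have e1 : inner ℝ g e = -‖g‖ := by
        rw [he, inner_neg_right, inner_smul_right, real_inner_self_eq_norm_sq]; field_simp
      have e2 : inner ℝ g q ≤ ‖g‖ * (1 / 4 * t) :=
        (real_inner_le_norm g q).trans (by gcongr)
      rw [hwx, inner_add_right, inner_smul_right, e1]; linarith
    have h2 := (abs_le.mp (by simpa using h)).2
    have h3 : ‖g‖ / 4 * ‖w - x‖ ≤ ‖g‖ / 4 * (5 / 4 * t) := by gcongr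
    have h4 := hcl x hx
    have h5 : 0 < ‖g‖ * t := by positivity
    rw [hΩeq]
    show ρ w < 0
    nlinarith

/-- Local Hölder estimate on the closure for functions satisfying the scaled interior estimate. -/
lemma hld_local {N : ℕ} {Ω : Set (Euc N)} (hΩo : IsOpen Ω) (hΩ2 : HasC2Boundary Ω)
    (α A : ℝ) (hα : 0 < α) (hA : 0 < A) (z : Euc N) (hz : z ∈ closure Ω) :
    ∃ K ≥ (0 : ℝ), ∃ r > (0 : ℝ), ∀ u : Euc N → ℝ, ContinuousOn u (closure Ω) →
      (∀ x₀ : Euc N, ∀ r : ℝ, 0 < r → r ≤ 1 → closedBall x₀ r ⊆ Ω → ∀ y : Euc N,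
        ‖y - x₀‖ ≤ r / 2 → u y - u x₀ ≤ A * ‖y - x₀‖ ^ α) →
      ∀ x ∈ closure Ω, ∀ y ∈ closure Ω, ‖x - z‖ < r → ‖y - z‖ < r →
        |u x - u y| ≤ K * ‖x - y‖ ^ α := by
  obtain ⟨e, c, hc, hc1, he, R, hR, hR1, hcone⟩ := hld_cone hΩo hΩ2 z hz
  set q : ℝ := 1 - c / 4 with hq
  have hq0 : 0 < q := by linarith
  have hq1 : q < 1 := by linarith
  have hqα : q ^ α < 1 := Real.rpow_lt_one hq0.le hq1 hα
  set B : ℝ := A / (1 - q ^ α) with hB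
  have hB0 : 0 < B := div_pos hA (by linarith)
  have hBA : A + B * q ^ α = B := by
    have : 1 - q ^ α ≠ 0 := by linarith
    rw [hB]; field_simp; ring
  refine ⟨2 * (B * (4 / c) ^ α) + A, by positivity, R * c / 8, by positivity, ?_⟩
  intro u hu hinter
  -- two-sided interior estimate
  have hinter2 : ∀ x₀ : Euc N, ∀ r : ℝ, 0 < r → r ≤ 1 → closedBall x₀ r ⊆ Ω → ∀ y : Euc N,
      ‖y - x₀‖ ≤ r / 4 → |u y - u x₀| ≤ A * ‖y - x₀‖ ^ α := by
    intro x₀ r hr hr1 hb y hy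
    rw [abs_le]
    have h1 := hinter x₀ r hr hr1 hb y (by linarith)
    have h2 := hinter y (r / 2) (by linarith) (by linarith) (by
      refine (closedBall_subset_closedBall' ?_).trans hb
      rw [dist_eq_norm]; linarith) x₀ (by rw [norm_sub_rev]; linarith)
    rw [norm_sub_rev] at h2
    constructor <;> linarith
  -- estimate along the inner direction
  have hrad : ∀ x ∈ closure Ω, ‖x - z‖ < R → ∀ t : ℝ, 0 < t → t ≤ R →
      |u (x + t • e) - u x| ≤ B * t ^ α := by
    intro x hx hxz
    have hstep : ∀ t : ℝ, 0 < t → t ≤ R →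
        |u (x + t • e) - u (x + (q * t) • e)| ≤ A * t ^ α := by
      intro t ht htR
      have hd : ‖x + (q * t) • e - (x + t • e)‖ ≤ c * t / 4 := by
        have : x + (q * t) • e - (x + t • e) = (-(c / 4 * t)) • e := by
          rw [hq]; module
        rw [this, norm_smul, norm_neg, Real.norm_of_nonneg (by positivity)]
        have : c / 4 * t * ‖e‖ ≤ c / 4 * t * 1 := by gcongr
        linarith
      rw [abs_sub_comm]
      refine (hinter2 (x + t • e) (c * t) (by positivity) (by nlinarith)
        (hcone x hx hxz t ht htR) _ hd).trans ?_
      have : c * t / 4 ≤ t := by nlinarith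
      gcongr
      exact hd.trans this
    have hiter : ∀ n : ℕ, ∀ t : ℝ, 0 < t → t ≤ R →
        |u (x + t • e) - u (x + (q ^ n * t) • e)| ≤ B * t ^ α := by
      intro n
      induction n with
      | zero => intro t ht _; simp; positivity
      | succ n ih =>
        intro t ht htR
        have h1 := hstep t ht htR
        have h2 := ih (q * t) (by positivity) (by nlinarith)
        rw [← mul_assoc, ← pow_succ, Real.mul_rpow hq0.le ht.le] at h2
        have h3 := abs_sub_le (u (x + t • e)) (u (x + (q * t) • e))
          (u (x + (q ^ (n + 1) * t) • e))
        have : A * t ^ α + B * (q ^ α * t ^ α) = B * t ^ α := by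
          rw [← hBA]; rw [hBA]
          calc _ = (A + B * q ^ α) * t ^ α := by ring
            _ = _ := by rw [hBA]
        linarith
    intro t ht htR
    have hlim : Tendsto (fun n : ℕ => x + (q ^ n * t) • e) atTop (𝓝[closure Ω] x) := by
      refine tendsto_nhdsWithin_iff.mpr ⟨?_, Eventually.of_forall fun n => ?_⟩
      · have h1 : Tendsto (fun n : ℕ => q ^ n) atTop (𝓝 0) :=
          tendsto_pow_atTop_nhds_zero_of_lt_one hq0.le hq1
        have h2 := (tendsto_const_nhds (x := x)).add ((h1.mul_const t).smul_const e)
        simpa using h2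
      · apply subset_closure
        have hqn : q ^ n ≤ 1 := pow_le_one₀ hq0.le hq1.le
        have hqn0 : 0 < q ^ n := by positivity
        exact hcone x hx hxz (q ^ n * t) (by positivity) (by nlinarith)
          (mem_closedBall_self (by positivity))
    have hul := (hu x hx).tendsto.comp hlim
    have := (tendsto_const_nhds (x := u (x + t • e))).sub hul |>.abs
    exact le_of_tendsto this (Eventually.of_forall fun n => hiter n t ht htR)
  intro x hx y hy hxz hyz
  by_cases hxy : x = y
  · subst hxy; simp; positivity
  set s : ℝ := ‖x - y‖ with hs
  have hs0 : 0 < s := norm_pos_iff.mpr (sub_ne_zero.mpr hxy)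
  have hsR : s < R * c / 4 := by
    have : x - y = (x - z) - (y - z) := by abel
    rw [hs, this]
    linarith [norm_sub_le (x - z) (y - z)]
  set t : ℝ := 4 / c * s with ht
  have ht0 : 0 < t := by positivity
  have htR : t ≤ R := by
    rw [ht, div_mul_eq_mul_div, div_le_iff₀ hc]; linarith
  have hRc : R * c / 8 ≤ R := by nlinarith
  have h1 := hrad x hx (by linarith) t ht0 htR
  have h2 := hrad y hy (by linarith) t ht0 htR
  have hct : c * t = 4 * s := by rw [ht]; field_simp
  have hdd : x + t • e - (y + t • e) = x - y := by abel
  have h3 := hinter2 (y + t • e) (c * t) (by positivity) (by nlinarith)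
    (hcone y hy (by linarith) t ht0 htR) (x + t • e) (by rw [hdd, hct]; linarith)
  rw [hdd, ← hs] at h3
  have htα : t ^ α = (4 / c) ^ α * s ^ α := Real.mul_rpow (by positivity) hs0.le
  rw [htα] at h1 h2
  have h4 := abs_sub_le (u x) (u (x + t • e)) (u y)
  have h5 := abs_sub_le (u (x + t • e)) (u (y + t • e)) (u y)
  rw [abs_sub_comm] at h1
  have : (2 * (B * (4 / c) ^ α) + A) * s ^ α
    = B * ((4 / c) ^ α * s ^ α) + B * ((4 / c) ^ α * s ^ α) + A * s ^ α := by ring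
  linarith

/-- From local to global. -/
lemma hld_global {N : ℕ} (X : Set (Euc N)) (hX : IsCompact X) (hXc : IsPreconnected X)
    (α : ℝ) (hα : 0 < α) (P : (Euc N → ℝ) → Prop)
    (hloc : ∀ z ∈ X, ∃ K ≥ (0 : ℝ), ∃ r > (0 : ℝ), ∀ u, P u →
      ∀ x ∈ X, ∀ y ∈ X, ‖x - z‖ < r → ‖y - z‖ < r → |u x - u y| ≤ K * ‖x - y‖ ^ α) :
    ∃ K > (0 : ℝ), ∀ u, P u → ∀ x ∈ X, ∀ y ∈ X, |u x - u y| ≤ K * ‖x - y‖ ^ α := by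
  rcases X.eq_empty_or_nonempty with rfl | ⟨x₀, hx₀⟩
  · exact ⟨1, one_pos, fun u _ x hx => absurd hx (notMem_empty x)⟩
  -- local oscillation bound
  have hosc : ∀ z ∈ X, ∃ r > (0 : ℝ), ∃ M : ℝ, ∀ u, P u → ∀ x ∈ X, ∀ y ∈ X,
      ‖x - z‖ < r → ‖y - z‖ < r → |u x - u y| ≤ M := by
    intro z hz
    obtain ⟨K, hK, r, hr, h⟩ := hloc z hz
    refine ⟨r, hr, K * (2 * r) ^ α, fun u hu x hx y hy hxz hyz => ?_⟩
    refine (h u hu x hx y hy hxz hyz).trans ?_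
    have : ‖x - y‖ ≤ 2 * r := by
      have e : x - y = (x - z) - (y - z) := by abel
      rw [e]; linarith [norm_sub_le (x - z) (y - z)]
    gcongr
  set G : Set (Euc N) := {x | ∃ M : ℝ, ∀ u, P u → |u x - u x₀| ≤ M} with hG
  have hmove : ∀ z ∈ X, ∃ r > (0 : ℝ), ∀ x ∈ X, ∀ y ∈ X, ‖x - z‖ < r → ‖y - z‖ < r →
      x ∈ G → y ∈ G := by
    intro z hz
    obtain ⟨r, hr, M, h⟩ := hosc z hz
    refine ⟨r, hr, fun x hx y hy hxz hyz ⟨M', hM'⟩ => ⟨M + M', fun u hu => ?_⟩⟩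
    have h1 := h u hu y hy x hx hyz hxz
    have h2 := hM' u hu
    linarith [abs_sub_le (u y) (u x) (u x₀)]
  have hall : X ⊆ G := by
    choose! ρ hρ hρm using hmove
    by_contra hcon
    rw [not_subset] at hcon
    obtain ⟨w, hwX, hwG⟩ := hcon
    set U : Set (Euc N) := ⋃ z ∈ X ∩ G, ball z (ρ z) with hU
    set V : Set (Euc N) := ⋃ z ∈ X \ G, ball z (ρ z) with hV
    have hUo : IsOpen U := isOpen_biUnion fun _ _ => isOpen_ball
    have hVo : IsOpen V := isOpen_biUnion fun _ _ => isOpen_ball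
    have hcov : X ⊆ U ∪ V := by
      intro z hz
      by_cases hzG : z ∈ G
      · exact Or.inl (mem_biUnion (⟨hz, hzG⟩ : z ∈ X ∩ G) (mem_ball_self (hρ z hz)))
      · exact Or.inr (mem_biUnion (⟨hz, hzG⟩ : z ∈ X \ G) (mem_ball_self (hρ z hz)))
    have hx₀G : x₀ ∈ G := ⟨0, fun u _ => by simp⟩
    obtain ⟨y, hyX, hyU, hyV⟩ := hXc U V hUo hVo hcov
      ⟨x₀, hx₀, mem_biUnion (⟨hx₀, hx₀G⟩ : x₀ ∈ X ∩ G) (mem_ball_self (hρ x₀ hx₀))⟩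
      ⟨w, hwX, mem_biUnion (⟨hwX, hwG⟩ : w ∈ X \ G) (mem_ball_self (hρ w hwX))⟩
    simp only [hU, hV, mem_iUnion, exists_prop, mem_ball, dist_eq_norm] at hyU hyV
    obtain ⟨z1, ⟨hz1, hz1G⟩, hy1⟩ := hyU
    obtain ⟨z2, ⟨hz2, hz2G⟩, hy2⟩ := hyV
    have hyG : y ∈ G := hρm z1 hz1 z1 hz1 y hyX (by simpa using hρ z1 hz1) hy1 hz1G
    exact hz2G (hρm z2 hz2 y hyX z2 hz2 hy2 (by simpa using hρ z2 hz2) hyG)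
  -- local bounds near each pair, then compactness of the product
  have hpair : ∃ K ≥ (0 : ℝ), ∀ u, P u → ∀ p ∈ X ×ˢ X, |u p.1 - u p.2| ≤ K * ‖p.1 - p.2‖ ^ α := by
    refine (hX.prod hX).induction_on
      (p := fun S => ∃ K ≥ (0 : ℝ), ∀ u, P u → ∀ p ∈ S, |u p.1 - u p.2| ≤ K * ‖p.1 - p.2‖ ^ α)
      ⟨0, le_rfl, fun u _ p hp => absurd hp (notMem_empty p)⟩ ?_ ?_ ?_
    · rintro S T hST ⟨K, hK, h⟩
      exact ⟨K, hK, fun u hu p hp => h u hu p (hST hp)⟩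
    · rintro S T ⟨K, hK, h⟩ ⟨K', hK', h'⟩
      refine ⟨K + K', by positivity, fun u hu p hp => ?_⟩
      have h0 : 0 ≤ ‖p.1 - p.2‖ ^ α := by positivity
      rcases hp with hp | hp
      · have := h u hu p hp; nlinarith
      · have := h' u hu p hp; nlinarith
    · rintro ⟨x, y⟩ ⟨hx, hy⟩
      simp only at hx hy
      by_cases hxy : x = y
      · subst hxy
        obtain ⟨K, hK, r, hr, h⟩ := hloc x hx
        refine ⟨(X ×ˢ X) ∩ (ball x r ×ˢ ball x r), inter_mem self_mem_nhdsWithin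
          (mem_nhdsWithin_of_mem_nhds (prod_mem_nhds (ball_mem_nhds x hr) (ball_mem_nhds x hr))),
          K, hK, ?_⟩
        rintro u hu ⟨p, q⟩ ⟨⟨hp, hq⟩, hp', hq'⟩
        rw [mem_ball, dist_eq_norm] at hp' hq'
        exact h u hu p hp q hq hp' hq'
      · obtain ⟨r1, hr1, M1, h1⟩ := hosc x hx
        obtain ⟨r2, hr2, M2, h2⟩ := hosc y hy
        obtain ⟨M3, h3⟩ := hall hx
        obtain ⟨M4, h4⟩ := hall hy
        set s : ℝ := ‖x - y‖ with hs
        have hs0 : 0 < s := norm_pos_iff.mpr (sub_ne_zero.mpr hxy)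
        set M : ℝ := |M1| + |M2| + |M3| + |M4| with hM
        have hM0 : 0 ≤ M := by positivity
        set a1 := min r1 (s / 4)
        set a2 := min r2 (s / 4)
        have ha1 : 0 < a1 := by positivity
        have ha2 : 0 < a2 := by positivity
        refine ⟨(X ×ˢ X) ∩ (ball x a1 ×ˢ ball y a2), inter_mem self_mem_nhdsWithin
          (mem_nhdsWithin_of_mem_nhds (prod_mem_nhds (ball_mem_nhds x ha1) (ball_mem_nhds y ha2))),
          M / (s / 2) ^ α, by positivity, ?_⟩
        rintro u hu ⟨p, q⟩ ⟨⟨hp, hq⟩, hp', hq'⟩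
        rw [mem_ball, dist_eq_norm] at hp' hq'
        simp only at hp hq hp' hq' ⊢
        have hp1 : ‖p - x‖ < r1 := hp'.trans_le (min_le_left _ _)
        have hp2 : ‖p - x‖ < s / 4 := hp'.trans_le (min_le_right _ _)
        have hq1 : ‖q - y‖ < r2 := hq'.trans_le (min_le_left _ _)
        have hq2 : ‖q - y‖ < s / 4 := hq'.trans_le (min_le_right _ _)
        have b1 := h1 u hu p hp x hx hp1 (by simpa using hr1)
        have b2 := h2 u hu q hq y hy hq1 (by simpa using hr2)
        have b3 := h3 u hu
        have b4 := h4 u hu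
        have hb : |u p - u q| ≤ M := by
          have c1 := abs_le.mp (b1.trans (le_abs_self M1))
          have c2 := abs_le.mp (b2.trans (le_abs_self M2))
          have c3 := abs_le.mp (b3.trans (le_abs_self M3))
          have c4 := abs_le.mp (b4.trans (le_abs_self M4))
          rw [abs_le]
          constructor <;> linarith
        have hpq : s / 2 ≤ ‖p - q‖ := by
          have e : x - y = (p - q) - (p - x) + (q - y) := by abel
          have n1 := norm_add_le ((p - q) - (p - x)) (q - y)
          have n2 := norm_sub_le (p - q) (p - x)
          rw [← e] at n1
          linarith
        have : (s / 2) ^ α ≤ ‖p - q‖ ^ α := by gcongr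
        have h0 : 0 < (s / 2) ^ α := by positivity
        calc |u p - u q| ≤ M := hb
          _ = M / (s / 2) ^ α * (s / 2) ^ α := by field_simp
          _ ≤ _ := by gcongr
  obtain ⟨K, hK, h⟩ := hpair
  refine ⟨K + 1, by positivity, fun u hu x hx y hy => ?_⟩
  have h0 : 0 ≤ ‖x - y‖ ^ α := by positivity
  have := h u hu (x, y) ⟨hx, hy⟩
  simp only at this
  linarith

/-- Global Hölder estimates uniform in `λ`,
Lemma 3.9 of the paper. -/
theorem stmt12 {N : ℕ} (hN : 1 ≤ N) (Ω : Set (Euc N))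
    (hΩo : IsOpen Ω) (hΩb : Bornology.IsBounded Ω) (hΩc : IsConnected Ω)
    (hΩ2 : HasC2Boundary Ω)
    (m : ℝ) (hm : 2 < m) (f : Euc N → ℝ) (hf : ContinuousOn f (closure Ω))
    (δ₀ : ℝ) (hδ₀ : 0 < δ₀)
    (hd : ContDiffOn ℝ 2 (fun x => infDist x (frontier Ω))
      {x ∈ Ω | infDist x (frontier Ω) < δ₀})
    (xstar : Euc N) (hxstar : xstar ∈ Ω) (hxd : δ₀ < infDist xstar (frontier Ω)) :
    ∃ K₂ > (0 : ℝ), ∀ lam : ℝ, 0 < lam → lam < 1 →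
      ∀ u : Euc N → ℝ, IsSCSolution Ω f lam m u →
        ∀ x ∈ closure Ω, ∀ y ∈ closure Ω,
          |(u x - u xstar) - (u y - u xstar)| ≤
            K₂ * ‖x - y‖ ^ ((m - 2) / (m - 1)) := by
  have hc : IsCompact (closure Ω) := hΩb.isCompact_closure
  have hα : 0 < (m - 2) / (m - 1) := div_pos (by linarith) (by linarith)
  obtain ⟨A, hA, hinter⟩ := hld_interior hc hm hf
  obtain ⟨K, hK, h⟩ := hld_global (closure Ω) hc hΩc.isPreconnected.closure
    ((m - 2) / (m - 1)) hα (fun u => ∃ lam : ℝ, 0 < lam ∧ IsSCSolution Ω f lam m u)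
    (fun z hz => by
      obtain ⟨K, hK, r, hr, h⟩ := hld_local hΩo hΩ2 ((m - 2) / (m - 1)) A hα hA z hz
      exact ⟨K, hK, r, hr, fun u ⟨lam, hl, hu⟩ => h u hu.1 (hinter lam hl u hu)⟩)
  refine ⟨K, hK, fun lam hl _ u hu x hx y hy => ?_⟩
  rw [sub_sub_sub_cancel_right]
  exact h u ⟨lam, hl, hu⟩ x hx y hy
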